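/- For every personalized bivalued chore instance with n agents, i.e., for each agent i there exist rationals 0 < s_i < l_i with v_i(c) ∈ {s_i, l_i} for every chore c, there exists an allocation, i.e., a partition (A_1,…,A_n) of M, such that v_i(A_i) ≤ (15/13)·MMS^n(v_i, M) for every agent i. (15/13-MMS allocations exist for personalized bivalued instances.) -/

import Mathlib

open Finset

variable {α : Type*} [DecidableEq α]

/-- The total cost of a bundle `S` of chores under the additive cost function `v`. -/
def bundleCost (v : α → ℚ) (S : Finset α) : ℚ := ∑ c ∈ S, v c

/-- `P` is a partition of `M` into `d` (possibly empty) bundles. -/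
def IsPartitionInto (M : Finset α) (d : ℕ) (P : Fin d → Finset α) : Prop :=
  (∀ j, P j ⊆ M) ∧ (∀ j k, j ≠ k → Disjoint (P j) (P k)) ∧ ∀ c ∈ M, ∃ j, c ∈ P j

/-- `μ` is the `d`-maximin share `MMS^d(v, M)`: the minimum, over all partitions of `M`
into `d` bundles, of the maximum bundle cost. -/
def IsMMS (v : α → ℚ) (M : Finset α) (d : ℕ) (μ : ℚ) : Prop :=
  (∃ P : Fin d → Finset α, IsPartitionInto M d P ∧ ∀ j, bundleCost v (P j) ≤ μ) ∧
    ∀ P : Fin d → Finset α, IsPartitionInto M d P → ∃ j, μ ≤ bundleCost v (P j)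

/-- `v` is bivalued on `M` with values `s < l`. -/
def Bivalued (v : α → ℚ) (M : Finset α) (s l : ℚ) : Prop :=
  0 < s ∧ s < l ∧ ∀ c ∈ M, v c = s ∨ v c = l

structure GoodPar (r μ τ w W : ℚ) (J Jm : ℕ) (T : ℕ → ℕ) : Prop where
  hr : 0 < r
  hw : 0 ≤ w
  hacc : ∀ j : ℕ, j ≤ J → (j : ℚ) * r + T j ≤ τ
  hO : ∀ j k : ℕ, (j : ℚ) * r + k ≤ μ → (j : ℚ) * w + k ≤ W
  hJm : ∀ j : ℕ, (j : ℚ) * r ≤ μ → j ≤ Jm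
  hJmJ : Jm ≤ J
  hJmW : (Jm : ℚ) * w ≤ W
  ha : W ≤ ((J : ℚ) + 1) * w
  hb : W ≤ (J : ℚ) * w + T J
  hc : ∀ j : ℕ, j < J → W - 1 < (j : ℚ) * w + T j
  hd : W ≤ T 0

lemma arith_le7 (r τ : ℚ) (hr : 1 < r) (hτ : τ < 15 / 2) (J : ℕ) (hJ : (J : ℚ) * r ≤ τ) :
    J ≤ 7 := by
  have : (J : ℚ) < 8 := by nlinarith [(Nat.cast_nonneg J : (0:ℚ) ≤ J)]
  have : J < 8 := by exact_mod_cast this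
  omega

/-- elimination of `r` -/
lemma arith_elim (r μ τ : ℚ) (hτ : τ = 15 / 13 * μ) (hμ : μ < 13 / 2)
    (I j : ℕ) (W O D : ℤ) (hI : τ < (I : ℚ) * r + D) (hI0 : 1 ≤ I)
    (hj : 1 ≤ j) (hO : (j : ℚ) * r + O ≤ μ) (hW' : τ < W + 1) :
    ((13 : ℤ) * I - 15 * j < 0) ∨
    15 * I * O < 15 * j * D + (13 * I - 15 * j) * (W + 1) ∧
    2 * (15 * I * O) < 2 * (15 * j * D) + (13 * I - 15 * j) * 15 := by
  rcases lt_or_ge ((13 : ℤ) * I - 15 * j) 0 with hc | hc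
  · exact Or.inl hc
  right
  have hI0' : (1 : ℚ) ≤ I := by exact_mod_cast hI0
  have hj' : (1 : ℚ) ≤ j := by exact_mod_cast hj
  have hc' : (0 : ℚ) ≤ 13 * I - 15 * j := by exact_mod_cast hc
  have h1 := mul_le_mul_of_nonneg_left hO (by linarith : (0 : ℚ) ≤ I)
  have h2 := mul_lt_mul_of_pos_left hI (by linarith : (0 : ℚ) < j)
  have h3 := mul_le_mul_of_nonneg_left hW'.le hc'
  have h4 := mul_le_mul_of_nonneg_left (by linarith : τ ≤ 15 / 2) hc'
  have h5 : μ = 13 / 15 * τ := by linarith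
  rw [h5] at h1
  constructor
  · have : (15 * I * O : ℚ) < 15 * j * D + (13 * I - 15 * j) * (W + 1) := by nlinarith
    exact_mod_cast this
  · have : (2 * (15 * I * O) : ℚ) < 2 * (15 * j * D) + (13 * I - 15 * j) * 15 := by nlinarith
    exact_mod_cast this

lemma arith_e1 (r μ τ : ℚ) (hr : 1 < r) (hτ : τ = 15 / 13 * μ) (hμ : μ < 13 / 2)
    (j : ℕ) (W O : ℤ)
    (hj : 1 ≤ j) (hO : (j : ℚ) * r + O ≤ μ)
    (hW' : τ < W + 1) :
    15 * (j + O) < 13 * (W + 1) ∧ 2 * (j + O) < 13 := by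
  have hj' : (1 : ℚ) ≤ j := by exact_mod_cast hj
  have h1 : (j : ℚ) < j * r := by nlinarith
  constructor
  · have : (15 * (j + O) : ℚ) < 13 * (W + 1) := by linarith
    exact_mod_cast this
  · have : (2 * (j + O) : ℚ) < 13 := by linarith
    exact_mod_cast this

lemma arith_JW (r τ : ℚ) (hr : 1 < r) (J : ℕ) (W T : ℤ) (hJ : (J : ℚ) * r + T ≤ τ)
    (hW' : τ < W + 1) : J + T ≤ W := by
  have hj' : (0 : ℚ) ≤ J := Nat.cast_nonneg J
  have h1 : (J : ℚ) ≤ J * r := by nlinarith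
  have : (J + T : ℚ) < W + 1 := by linarith
  have : J + T < W + 1 := by exact_mod_cast this
  omega

lemma arith_W7 (τ : ℚ) (hτ : τ < 15 / 2) (W : ℤ) (hW : (W : ℚ) ≤ τ) : W ≤ 7 := by
  have : (W : ℚ) < 8 := by linarith
  have : W < 8 := by exact_mod_cast this
  omega

lemma arith_a (r μ τ : ℚ) (hr : 1 < r) (hτ : τ = 15 / 13 * μ) (hμ : μ < 13 / 2)
    (J j : ℕ) (W O : ℤ) (hJ : (J : ℚ) * r ≤ τ) (hJ' : τ < ((J : ℚ) + 1) * r)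
    (hj : 1 ≤ j) (hjJ : j ≤ J) (hO : (j : ℚ) * r + O ≤ μ) (hO0 : 0 ≤ O)
    (hW : (W : ℚ) ≤ τ) (hW' : τ < W + 1) :
    (j : ℤ) * W ≤ ((J : ℤ) + 1) * (W - O) := by
  have hJ7 := arith_le7 r τ hr (by linarith) J hJ
  have hW7 := arith_W7 τ (by linarith) W hW
  have hJW := arith_JW r τ hr J W 0 (by simpa using hJ) hW'
  have e1 := arith_e1 r μ τ hr hτ hμ j W O hj hO hW'
  have e2 := arith_elim r μ τ hτ hμ (J + 1) j W O 0 (by push_cast; linarith) (by omega) hj hO hW'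
  clear hJ hJ' hO hW hW' hτ hμ hr
  interval_cases J <;> interval_cases j <;> push_cast at * <;> (try simp only [false_or] at *) <;> omega

lemma arith_b (r μ τ : ℚ) (hr : 1 < r) (hτ : τ = 15 / 13 * μ) (hμ : μ < 13 / 2)
    (J j : ℕ) (W O T : ℤ) (hJ : (J : ℚ) * r + T ≤ τ) (hT : τ < (J : ℚ) * r + T + 1)
    (hT0 : 0 ≤ T) (hJ' : τ < ((J : ℚ) + 1) * r)
    (hj : 1 ≤ j) (hjJ : j < J) (hO : (j : ℚ) * r + O ≤ μ) (hO0 : 0 ≤ O)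
    (hW : (W : ℚ) ≤ τ) (hW' : τ < W + 1) :
    (j : ℤ) * W ≤ (J : ℤ) * (W - O) + j * T := by
  have hT0' : (0 : ℚ) ≤ T := by exact_mod_cast hT0
  have hJ7 := arith_le7 r τ hr (by linarith) J (by linarith)
  have hW7 := arith_W7 τ (by linarith) W hW
  have hJW := arith_JW r τ hr J W T hJ hW'
  have e1 := arith_e1 r μ τ hr hτ hμ j W O hj hO hW'
  have e2 := arith_elim r μ τ hτ hμ (J + 1) j W O 0 (by push_cast; linarith) (by omega) hj hO hW'
  have e3 := arith_elim r μ τ hτ hμ J j W O (T + 1) (by push_cast; linarith) (by omega) hj hO hW'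
  clear hJ hJ' hO hW hW' hτ hμ hr hT hT0'
  interval_cases J <;> interval_cases j <;> push_cast at * <;> (try simp only [false_or] at *) <;> omega

lemma arith_c (r μ τ : ℚ) (hr : 1 < r) (hτ : τ = 15 / 13 * μ) (hμ : μ < 13 / 2)
    (i j : ℕ) (W O T : ℤ) (hi : (i : ℚ) * r + T ≤ τ) (hT : τ < (i : ℚ) * r + T + 1)
    (hT0 : 0 ≤ T) (hi' : ((i : ℚ) + 1) * r ≤ τ)
    (hj : 1 ≤ j) (hij : j < i) (hO : (j : ℚ) * r + O ≤ μ) (hO0 : 0 ≤ O)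
    (hW : (W : ℚ) ≤ τ) (hW' : τ < W + 1) :
    (j : ℤ) * (W - 1) < (i : ℤ) * (W - O) + j * T := by
  have hi7 := arith_le7 r τ hr (by linarith) (i + 1) (by push_cast; linarith)
  have hW7 := arith_W7 τ (by linarith) W hW
  have hJW := arith_JW r τ hr i W T hi hW'
  have e1 := arith_e1 r μ τ hr hτ hμ j W O hj hO hW'
  have e3 := arith_elim r μ τ hτ hμ i j W O (T + 1) (by push_cast; linarith) (by omega) hj hO hW'
  have e4 : W < (i + 1) * (T + 1) := by
    have : (W : ℚ) < (i + 1) * (T + 1) := by nlinarith [(Nat.cast_nonneg i : (0:ℚ) ≤ i)]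
    exact_mod_cast this
  clear hi hi' hO hW hW' hτ hμ hr hT
  have hi6 : i ≤ 6 := by omega
  interval_cases i <;> interval_cases j <;> push_cast at * <;> (try simp only [false_or] at *) <;> omega

lemma arith_main (r μ τ : ℚ) (hr : 1 < r) (hμ : 0 ≤ μ) (hτ : τ = 15 / 13 * μ) :
    ∃ (w W : ℚ) (J Jm : ℕ) (T : ℕ → ℕ), GoodPar r μ τ w W J Jm T := by
  have hr0 : 0 < r := by linarith
  have hτ0 : 0 ≤ τ := by linarith
  have hμτ : μ ≤ τ := by linarith
  set J := ⌊τ / r⌋₊ with hJd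
  set Jm := ⌊μ / r⌋₊ with hJmd
  set T : ℕ → ℕ := fun j => ⌊τ - j * r⌋₊ with hTd
  have hJ : (J : ℚ) * r ≤ τ := by
    have := Nat.floor_le (div_nonneg hτ0 hr0.le)
    rwa [le_div_iff₀ hr0] at this
  have hJ' : τ < ((J : ℚ) + 1) * r := by
    have := Nat.lt_floor_add_one (τ / r)
    rwa [div_lt_iff₀ hr0] at this
  have hJmr : (Jm : ℚ) * r ≤ μ := by
    have := Nat.floor_le (div_nonneg hμ hr0.le)
    rwa [le_div_iff₀ hr0] at this
  have hJm : ∀ j : ℕ, (j : ℚ) * r ≤ μ → j ≤ Jm := by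
    intro j hj
    exact Nat.le_floor (by rwa [le_div_iff₀ hr0])
  have hJmJ : Jm ≤ J := Nat.floor_mono (by gcongr)
  have hjJ : ∀ j : ℕ, j ≤ J → (j : ℚ) * r ≤ τ := by
    intro j hj
    have : (j : ℚ) ≤ J := by exact_mod_cast hj
    nlinarith
  have hacc : ∀ j : ℕ, j ≤ J → (j : ℚ) * r + T j ≤ τ := by
    intro j hj
    have := Nat.floor_le (sub_nonneg.2 (hjJ j hj))
    linarith
  have hT' : ∀ j : ℕ, τ < (j : ℚ) * r + T j + 1 := by
    intro j
    have := Nat.lt_floor_add_one (τ - j * r)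
    linarith
  have hW : (T 0 : ℚ) ≤ τ := by have := hacc 0 (by omega); simpa using this
  have hW' : τ < T 0 + 1 := by have := hT' 0; simpa using this
  by_cases h65 : 13 / 2 ≤ μ
  · refine ⟨r, μ, J, Jm, T, hr0, hr0.le, hacc, fun _ _ h => h, hJm, hJmJ, hJmr, by linarith, ?_, ?_, ?_⟩
    · have := hT' J; linarith
    · intro j _; have := hT' j; linarith
    · linarith
  push Not at h65
  by_cases hJm0 : Jm = 0
  · refine ⟨T 0, T 0, J, Jm, T, hr0, by positivity, hacc, ?_, hJm, hJmJ, ?_, ?_, ?_, ?_, le_rfl⟩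
    · intro j k h
      have : (j : ℚ) * r ≤ μ := by have : (0 : ℚ) ≤ k := by positivity
                                   linarith
      have := hJm j this
      have : j = 0 := by omega
      subst this
      have hk : k ≤ T 0 := Nat.le_floor (by simp at h ⊢; linarith)
      simpa using hk
    · simp [hJm0]
    · have : (0 : ℚ) ≤ J * T 0 := by positivity
      linarith
    · rcases Nat.eq_zero_or_pos J with h | h
      · rw [h]; simp
      · have h1 : (1 : ℚ) ≤ J := by exact_mod_cast h
        have h2 : (0 : ℚ) ≤ T J := by positivity
        have h3 : (0 : ℚ) ≤ T 0 := by positivity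
        nlinarith
    · intro j _
      rcases Nat.eq_zero_or_pos j with h | h
      · rw [h]; simp
      · have h1 : (1 : ℚ) ≤ j := by exact_mod_cast h
        have h2 : (0 : ℚ) ≤ T j := by positivity
        have h3 : (0 : ℚ) ≤ T 0 := by positivity
        nlinarith
  · set O : ℕ → ℕ := fun j => ⌊μ - j * r⌋₊ with hOd
    have hOle : ∀ j : ℕ, j ≤ Jm → (j : ℚ) * r + O j ≤ μ := by
      intro j hj
      have : (j : ℚ) ≤ Jm := by exact_mod_cast hj
      have := Nat.floor_le (sub_nonneg.2 (by nlinarith : (j : ℚ) * r ≤ μ))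
      linarith
    have hOT : ∀ j : ℕ, O j ≤ T j := fun j => Nat.floor_mono (by linarith)
    have hOW : ∀ j : ℕ, O j ≤ T 0 := fun j => Nat.floor_mono (by
      have : (0 : ℚ) ≤ j * r := by positivity
      simp; linarith)
    obtain ⟨j0, hj0, hmin⟩ := Finset.exists_min_image (Finset.Icc 1 Jm)
      (fun j : ℕ => ((T 0 : ℚ) - O j) / j) ⟨1, by simp; omega⟩
    simp only [Finset.mem_Icc] at hj0 hmin
    have hj0' : (0 : ℚ) < j0 := by exact_mod_cast hj0.1
    set w : ℚ := ((T 0 : ℚ) - O j0) / j0 with hwd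
    have hwj : w * j0 = (T 0 : ℚ) - O j0 := by rw [hwd]; field_simp
    have hOj0 := hOle j0 hj0.2
    have hmul : ∀ j : ℕ, j ≤ Jm → (j : ℚ) * w + O j ≤ T 0 := by
      intro j hj
      rcases Nat.eq_zero_or_pos j with h | h
      · subst h
        have : (O 0 : ℚ) ≤ T 0 := by exact_mod_cast hOW 0
        simpa using this
      · have := hmin j ⟨h, hj⟩
        rw [le_div_iff₀ (by exact_mod_cast h)] at this
        linarith
    have key : ∀ x : ℚ, x * j0 ≤ 0 → x ≤ 0 := fun x hx => by
      by_contra h; push Not at h; nlinarith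
    have keys : ∀ x : ℚ, x * j0 < 0 → x < 0 := fun x hx => by
      by_contra h; push Not at h; nlinarith
    refine ⟨w, T 0, J, Jm, T, hr0, ?_, hacc, ?_, hJm, hJmJ, ?_, ?_, ?_, ?_, le_rfl⟩
    · have : (O j0 : ℚ) ≤ T 0 := by exact_mod_cast hOW j0
      exact div_nonneg (by linarith) hj0'.le
    · intro j k h
      have hjr : (j : ℚ) * r ≤ μ := by have : (0 : ℚ) ≤ k := by positivity
                                       linarith
      have hk : k ≤ O j := Nat.le_floor (by linarith)
      have hk : (k : ℚ) ≤ O j := by exact_mod_cast hk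
      linarith [hmul j (hJm j hjr)]
    · have := hmul Jm le_rfl
      have h2 : (0 : ℚ) ≤ O Jm := by positivity
      linarith
    · have := arith_a r μ τ hr hτ h65 J j0 (T 0) (O j0) hJ hJ' hj0.1 (by omega)
        (by push_cast; exact hOj0) (by positivity) (by push_cast; exact hW) (by push_cast; exact hW')
      have : (j0 * T 0 : ℚ) ≤ (J + 1) * (T 0 - O j0) := by exact_mod_cast this
      rw [← hwj] at this
      refine sub_nonpos.1 (key _ ?_)
      linarith
    · rcases eq_or_lt_of_le (hj0.2.trans hJmJ) with h | h
      · rw [← h]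
        have : (O j0 : ℚ) ≤ T j0 := by exact_mod_cast hOT j0
        linarith
      · have := arith_b r μ τ hr hτ h65 J j0 (T 0) (O j0) (T J) (by push_cast; exact hacc J le_rfl)
          (by push_cast; exact hT' J) (by positivity) hJ' hj0.1 h
          (by push_cast; exact hOj0) (by positivity) (by push_cast; exact hW) (by push_cast; exact hW')
        have : (j0 * T 0 : ℚ) ≤ J * (T 0 - O j0) + j0 * T J := by exact_mod_cast this
        rw [← hwj] at this
        refine sub_nonpos.1 (key _ ?_)
        linarith
    · intro i hi
      rcases le_or_gt i j0 with h | h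
      · have h' : (i : ℚ) ≤ j0 := by exact_mod_cast h
        refine sub_neg.1 (keys _ ?_)
        have h1 : (T 0 - 1 - (i * w + T i)) * j0 = (T 0 - T i - 1 : ℚ) * j0 - i * (T 0 - O j0) := by
          rw [← hwj]; ring
        rw [h1]
        have h2 := mul_lt_mul_of_pos_left (hT' i) hj0'
        have h3 := mul_le_mul_of_nonneg_left hW (sub_nonneg.2 h')
        have h4 := mul_le_mul_of_nonneg_left hOj0 (Nat.cast_nonneg i : (0:ℚ) ≤ i)
        have h5 := mul_le_mul_of_nonneg_left hμτ (Nat.cast_nonneg i : (0:ℚ) ≤ i)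
        nlinarith
      · have hi1 : (((i : ℕ) : ℚ) + 1) * r ≤ τ := by
          have := hjJ (i + 1) hi
          push_cast at this; exact this
        have := arith_c r μ τ hr hτ h65 i j0 (T 0) (O j0) (T i) (by push_cast; exact hacc i hi.le)
          (by push_cast; exact hT' i) (by positivity) hi1 hj0.1 h
          (by push_cast; exact hOj0) (by positivity) (by push_cast; exact hW) (by push_cast; exact hW')
        have : (j0 * (T 0 - 1) : ℚ) < i * (T 0 - O j0) + j0 * T i := by exact_mod_cast this
        rw [← hwj] at this
        refine sub_neg.1 (keys _ ?_)
        linarith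

def InvN (w W : ℚ) (Jm T0 n L S : ℕ) : Prop :=
  L ≤ n * Jm ∧ (L = 0 → S ≤ n * T0) ∧ (0 < L → (L : ℚ) * w + S ≤ n * W)

lemma InvN.step {r μ τ w W : ℚ} {J Jm : ℕ} {T : ℕ → ℕ} (g : GoodPar r μ τ w W J Jm T)
    {n L S j k : ℕ} (h : InvN w W Jm (T 0) (n + 1) L S) (hjL : j ≤ L) (hkS : k ≤ S)
    (hj : min L J ≤ j) (hk : j = min L J → min S (T j) ≤ k) :
    InvN w W Jm (T 0) n (L - j) (S - k) := by
  obtain ⟨h1, h2, h3⟩ := h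
  have hJmJ := g.hJmJ
  have hL1 : L - j ≤ n * Jm := by
    have : (n + 1) * Jm = n * Jm + Jm := by ring
    rcases le_total L J with h | h
    · rw [min_eq_left h] at hj
      have : L - j = 0 := by omega
      omega
    · rw [min_eq_right h] at hj
      omega
  have cS : ((S - k : ℕ) : ℚ) = S - k := by push_cast [hkS]; ring
  have cL : ((L - j : ℕ) : ℚ) = L - j := by push_cast [hjL]; ring
  have hn0 : (0 : ℚ) ≤ n := Nat.cast_nonneg n
  -- real bound in the case `J ≤ L`
  have big : J ≤ L → 0 < L → S - k = 0 ∨ ((L - j : ℕ) : ℚ) * w + (S - k : ℕ) ≤ n * W := by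
    intro hJL hL
    have h3 := h3 hL
    push_cast at h3
    rw [cS, cL]
    rw [min_eq_right hJL] at hj hk
    rcases eq_or_lt_of_le hj with e | e
    · have hk := hk e.symm
      rcases le_total S (T j) with h | h
      · left; rw [min_eq_left h] at hk; omega
      · right
        rw [min_eq_right h] at hk
        have hb := g.hb
        rw [e] at hb
        have : (T j : ℚ) ≤ k := by exact_mod_cast hk
        nlinarith
    · right
      have ha := g.ha
      have : (J : ℚ) + 1 ≤ j := by exact_mod_cast e
      have := mul_le_mul_of_nonneg_right this g.hw
      have : (0 : ℚ) ≤ k := Nat.cast_nonneg k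
      nlinarith
  refine ⟨hL1, ?_, ?_⟩
  · intro hL0
    rcases Nat.eq_zero_or_pos L with hL | hL
    · subst hL
      have hj0 : j = 0 := by omega
      subst hj0
      have h2 := h2 rfl
      have hk := hk (by simp)
      have : (n + 1) * T 0 = n * T 0 + T 0 := by ring
      rcases le_total S (T 0) with h | h
      · rw [min_eq_left h] at hk; omega
      · rw [min_eq_right h] at hk; omega
    · rcases lt_or_ge L J with hLJ | hLJ
      · rw [min_eq_left hLJ.le] at hj hk
        have e : j = L := by omega
        have hk := hk e
        rcases le_total S (T j) with h | h
        · rw [min_eq_left h] at hk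
          have : S - k = 0 := by omega
          omega
        · rw [min_eq_right h] at hk
          have hc := g.hc L hLJ
          have h3 := h3 hL
          push_cast at h3
          have hd := mul_le_mul_of_nonneg_left g.hd hn0
          rw [e] at hk
          have : (T L : ℚ) ≤ k := by exact_mod_cast hk
          have : ((S - k : ℕ) : ℚ) < n * T 0 + 1 := by rw [cS]; nlinarith
          have : S - k < n * T 0 + 1 := by exact_mod_cast this
          omega
      · rcases big hLJ hL with h | h
        · omega
        · rw [hL0] at h
          have hd := mul_le_mul_of_nonneg_left g.hd hn0
          have : ((S - k : ℕ) : ℚ) ≤ n * T 0 := by push_cast at h ⊢; linarith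
          exact_mod_cast this
  · intro hL0
    have hLJ : J ≤ L := by
      by_contra hh
      rw [min_eq_left (by omega)] at hj
      omega
    rcases big hLJ (by omega) with h | h
    · rw [h]
      have : ((L - j : ℕ) : ℚ) ≤ n * Jm := by exact_mod_cast hL1
      have h4 := mul_le_mul_of_nonneg_right this g.hw
      have h5 := mul_le_mul_of_nonneg_left g.hJmW hn0
      push_cast
      linarith
    · exact h

lemma InvN.last {r μ τ w W : ℚ} {J Jm : ℕ} {T : ℕ → ℕ} (g : GoodPar r μ τ w W J Jm T)
    {L S : ℕ} (h : InvN w W Jm (T 0) 1 L S) : (L : ℚ) * r + S ≤ τ := by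
  obtain ⟨h1, h2, h3⟩ := h
  have hLJ : L ≤ J := by have := g.hJmJ; omega
  have hacc := g.hacc L hLJ
  suffices S ≤ T L by
    have : (S : ℚ) ≤ T L := by exact_mod_cast this
    linarith
  rcases Nat.eq_zero_or_pos L with hL | hL
  · subst hL; have := h2 rfl; omega
  · have h3 := h3 hL
    have : W - 1 < (L : ℚ) * w + T L := by
      rcases eq_or_lt_of_le hLJ with e | e
      · have := g.hb; rw [e]; linarith
      · exact g.hc L e
    have : (S : ℚ) < T L + 1 := by push_cast at h3; linarith
    have : S < T L + 1 := by exact_mod_cast this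
    omega

/-- number of large and small positions -/
def nL (t : ℕ) (R : Finset ℕ) : ℕ := #(R.filter (fun p => t ≤ p))
def nS (t : ℕ) (R : Finset ℕ) : ℕ := #(R.filter (fun p => ¬ t ≤ p))

lemma nL_sdiff (t : ℕ) {R B : Finset ℕ} (h : B ⊆ R) : nL t (R \ B) = nL t R - nL t B := by
  unfold nL
  rw [← Finset.card_sdiff_of_subset (Finset.filter_subset_filter _ h)]
  congr 1; ext; simp only [Finset.mem_filter, Finset.mem_sdiff]; tauto

lemma nS_sdiff (t : ℕ) {R B : Finset ℕ} (h : B ⊆ R) : nS t (R \ B) = nS t R - nS t B := by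
  unfold nS
  rw [← Finset.card_sdiff_of_subset (Finset.filter_subset_filter _ h)]
  congr 1; ext; simp only [Finset.mem_filter, Finset.mem_sdiff]; tauto

lemma ordered {ι : Type*} [DecidableEq ι] (t : ι → ℕ) (r μ τ w W : ι → ℚ) (J Jm : ι → ℕ)
    (T : ι → ℕ → ℕ) (g : ∀ i, GoodPar (r i) (μ i) (τ i) (w i) (W i) (J i) (Jm i) (T i)) (n : ℕ) :
    ∀ (N : Finset ι), #N = n + 1 → ∀ R : Finset ℕ,
      (∀ i ∈ N, InvN (w i) (W i) (Jm i) (T i 0) (n + 1) (nL (t i) R) (nS (t i) R)) →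
      ∃ f : ℕ → ι, (∀ p ∈ R, f p ∈ N) ∧ ∀ i ∈ N,
        (nL (t i) (R.filter (fun p => f p = i)) : ℚ) * r i
          + nS (t i) (R.filter (fun p => f p = i)) ≤ τ i := by
  induction n with
  | zero =>
    intro N hN R hR
    obtain ⟨i, rfl⟩ := Finset.card_eq_one.1 hN
    refine ⟨fun _ => i, by simp, ?_⟩
    intro i' hi'
    rw [Finset.mem_singleton] at hi'
    subst hi'
    simpa using InvN.last (g i') (hR i' (by simp))
  | succ n ih =>
    intro N hN R hR
    classical
    let acc : ι → Finset ℕ → Prop := fun i B => (nL (t i) B : ℚ) * r i + nS (t i) B ≤ τ i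
    have hNne : N.Nonempty := Finset.card_pos.1 (by omega)
    obtain ⟨i0, hi0⟩ := hNne
    obtain ⟨B, hB, hmax⟩ := Finset.exists_max_image
      (R.powerset.filter (fun B => ∃ i ∈ N, acc i B)) (fun B => toColex B) ⟨∅, by
        simp only [Finset.mem_filter, Finset.empty_mem_powerset, true_and]
        refine ⟨i0, hi0, ?_⟩
        have h := (g i0).hacc 0 (by omega)
        have : (0 : ℚ) ≤ T i0 0 := Nat.cast_nonneg _
        simp [acc, nL, nS]
        push_cast at h; linarith⟩
    simp only [Finset.mem_filter, Finset.mem_powerset] at hB hmax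
    obtain ⟨hBR, i, hi, hacci⟩ := hB
    have hstep : ∀ i' ∈ N.erase i, InvN (w i') (W i') (Jm i') (T i' 0) (n + 1)
        (nL (t i') (R \ B)) (nS (t i') (R \ B)) := by
      intro i' hi'
      have hi'N := Finset.mem_of_mem_erase hi'
      rw [nL_sdiff _ hBR, nS_sdiff _ hBR]
      have g' := g i'
      have hjL : nL (t i') B ≤ nL (t i') R := card_le_card (filter_subset_filter _ hBR)
      have hkS : nS (t i') B ≤ nS (t i') R := card_le_card (filter_subset_filter _ hBR)
      have claim1 : min (nL (t i') R) (J i') ≤ nL (t i') B := by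
        by_contra hlt
        push Not at hlt
        rw [lt_min_iff] at hlt
        obtain ⟨p, hp, hpB⟩ := Finset.exists_mem_notMem_of_card_lt_card hlt.1
        simp only [Finset.mem_filter, not_and'] at hp hpB
        have hpB := hpB hp.2
        set B' := insert p (B.filter (fun q => t i' ≤ q)) with hB'
        have hL : nL (t i') B' = nL (t i') B + 1 := by
          unfold nL
          rw [hB', Finset.filter_insert, if_pos hp.2, Finset.filter_filter,
            Finset.card_insert_of_notMem (by simp [hpB])]
          simp
        have hS : nS (t i') B' = 0 := by
          unfold nS
          rw [Finset.card_eq_zero, Finset.filter_eq_empty_iff]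
          intro q hq
          rw [hB', Finset.mem_insert, Finset.mem_filter] at hq
          rcases hq with rfl | hq
          · simpa using hp.2
          · simpa using hq.2
        have hle := hmax B' ⟨?_, i', hi'N, ?_⟩
        · rw [Finset.Colex.toColex_le_toColex] at hle
          obtain ⟨b, hb, hb', hpb⟩ := hle (Finset.mem_insert_self p _) hpB
          apply hb'
          rw [hB', Finset.mem_insert, Finset.mem_filter]
          exact Or.inr ⟨hb, hp.2.trans hpb⟩
        · intro q hq
          rw [hB', Finset.mem_insert, Finset.mem_filter] at hq
          rcases hq with rfl | hq
          · exact hp.1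
          · exact hBR hq.1
        · have h := g'.hacc (nL (t i') B + 1) hlt.2
          have h2 : (0 : ℚ) ≤ T i' (nL (t i') B + 1) := Nat.cast_nonneg _
          simp only [acc]
          rw [hL, hS]
          push_cast at h ⊢
          linarith
      refine InvN.step g' (hR i' hi'N) hjL hkS claim1 ?_
      intro hjeq
      by_contra hlt
      push Not at hlt
      rw [lt_min_iff] at hlt
      obtain ⟨p, hp, hpB⟩ := Finset.exists_mem_notMem_of_card_lt_card hlt.1
      simp only [Finset.mem_filter, not_and'] at hp hpB
      have hpB := hpB hp.2
      have hL : nL (t i') (insert p B) = nL (t i') B := by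
        unfold nL
        rw [Finset.filter_insert, if_neg hp.2]
      have hS : nS (t i') (insert p B) = nS (t i') B + 1 := by
        unfold nS
        rw [Finset.filter_insert, if_pos hp.2, Finset.card_insert_of_notMem (by simp [hpB])]
      have hle := hmax (insert p B) ⟨?_, i', hi'N, ?_⟩
      · rw [Finset.Colex.toColex_le_toColex] at hle
        obtain ⟨b, hb, hb', hpb⟩ := hle (Finset.mem_insert_self p _) hpB
        exact hb' (Finset.mem_insert_of_mem hb)
      · exact Finset.insert_subset hp.1 hBR
      · have h := g'.hacc (nL (t i') B) (by rw [hjeq]; exact min_le_right _ _)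
        have h2 : (nS (t i') B + 1 : ℚ) ≤ T i' (nL (t i') B) := by exact_mod_cast hlt.2
        simp only [acc]
        rw [hL, hS]
        push_cast
        linarith
    obtain ⟨f, hf, hf'⟩ := ih (N.erase i) (by rw [Finset.card_erase_of_mem hi]; omega) (R \ B) hstep
    refine ⟨fun p => if p ∈ B then i else f p, ?_, ?_⟩
    · intro p hp
      by_cases hpB : p ∈ B
      · simp [hpB, hi]
      · simp only [hpB, if_false]
        exact Finset.mem_of_mem_erase (hf p (by simp [hp, hpB]))
    · intro i' hi'
      by_cases hii : i' = i
      · subst hii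
        have : R.filter (fun p => (if p ∈ B then i' else f p) = i') = B := by
          ext p
          simp only [Finset.mem_filter]
          constructor
          · rintro ⟨hp, h⟩
            by_contra hpB
            rw [if_neg hpB] at h
            have := hf p (by simp [hp, hpB])
            rw [h] at this
            simp at this
          · intro hpB
            exact ⟨hBR hpB, by simp [hpB]⟩
        rw [this]
        exact hacci
      · have : R.filter (fun p => (if p ∈ B then i else f p) = i')
            = (R \ B).filter (fun p => f p = i') := by
          ext p
          simp only [Finset.mem_filter, Finset.mem_sdiff]
          by_cases hpB : p ∈ B
          · simp [hpB, Ne.symm hii]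
          · simp [hpB]
        rw [this]
        exact hf' i' (Finset.mem_erase.2 ⟨hii, hi'⟩)

/-- Reduction to identically ordered instances. -/
lemma ido {ι : Type*} [DecidableEq ι] (t : ι → ℕ) (big : ι → α → Prop)
    [∀ i, DecidablePred (big i)] (f : ℕ → ι) (m : ℕ) :
    ∀ (M : Finset α) (R : Finset ℕ), #M = m → #R = m →
      (∀ i, #(M.filter (big i)) ≤ nL (t i) R) →
      ∃ a : α → ι, ∀ i, #(M.filter (fun c => a c = i)) = #(R.filter (fun p => f p = i)) ∧
        #((M.filter (fun c => a c = i)).filter (big i)) ≤ nL (t i) (R.filter (fun p => f p = i)) := by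
  induction m with
  | zero =>
    intro M R hM hR _
    rw [Finset.card_eq_zero] at hM hR
    subst hM hR
    exact ⟨fun _ => f 0, by simp⟩
  | succ m ih =>
    intro M R hM hR h
    have hRne : R.Nonempty := Finset.card_pos.1 (by omega)
    have hMne : M.Nonempty := Finset.card_pos.1 (by omega)
    set p := R.min' hRne with hp
    have hpR : p ∈ R := Finset.min'_mem _ _
    have hpmin : ∀ q ∈ R, p ≤ q := fun q hq => Finset.min'_le _ _ hq
    have hex : ∃ c ∈ M, big (f p) c → t (f p) ≤ p := by
      by_cases hpt : t (f p) ≤ p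
      · obtain ⟨c, hc⟩ := hMne
        exact ⟨c, hc, fun _ => hpt⟩
      · by_contra hcon
        push Not at hcon
        have h1 : M.filter (big (f p)) = M := Finset.filter_true_of_mem (fun c hc => (hcon c hc).1)
        have h2 := h (f p)
        rw [h1] at h2
        have h3 : nL (t (f p)) R < #R := by
          apply Finset.card_lt_card
          rw [Finset.filter_ssubset]
          exact ⟨p, hpR, hpt⟩
        omega
    obtain ⟨c, hcM, hc⟩ := hex
    obtain ⟨a, ha⟩ := ih (M.erase c) (R.erase p) (by rw [Finset.card_erase_of_mem hcM]; omega)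
      (by rw [Finset.card_erase_of_mem hpR]; omega) (by
        intro i
        by_cases hpt : t i ≤ p
        · have h1 : nL (t i) (R.erase p) = m := by
            unfold nL
            rw [Finset.filter_true_of_mem, Finset.card_erase_of_mem hpR]
            · omega
            · intro q hq
              exact hpt.trans (hpmin q (Finset.mem_of_mem_erase hq))
          rw [h1]
          refine (Finset.card_filter_le _ _).trans ?_
          rw [Finset.card_erase_of_mem hcM]; omega
        · have h1 : nL (t i) (R.erase p) = nL (t i) R := by
            unfold nL
            congr 1
            ext q
            simp only [Finset.mem_filter, Finset.mem_erase]
            constructor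
            · tauto
            · rintro ⟨h1, h2⟩
              exact ⟨⟨by rintro rfl; exact hpt h2, h1⟩, h2⟩
          rw [h1]
          exact (Finset.card_le_card (Finset.filter_subset_filter _ (Finset.erase_subset _ _))).trans (h i))
    refine ⟨fun x => if x = c then f p else a x, ?_⟩
    intro i
    by_cases hi : f p = i
    · have e1 : M.filter (fun x => (if x = c then f p else a x) = i)
          = insert c ((M.erase c).filter (fun x => a x = i)) := by
        ext x
        simp only [Finset.mem_filter, Finset.mem_insert, Finset.mem_erase]
        by_cases hx : x = c
        · simp [hx, hcM, hi]
        · simp [hx]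
      have e2 : R.filter (fun q => f q = i) = insert p ((R.erase p).filter (fun q => f q = i)) := by
        ext x
        simp only [Finset.mem_filter, Finset.mem_insert, Finset.mem_erase]
        by_cases hx : x = p
        · simp [hx, hpR, hi]
        · simp [hx]
      rw [e1, e2]
      constructor
      · rw [Finset.card_insert_of_notMem (by simp), Finset.card_insert_of_notMem (by simp), (ha i).1]
      · have h2 := (ha i).2
        unfold nL at h2 ⊢
        rw [Finset.filter_insert, Finset.filter_insert]
        rw [hi] at hc
        by_cases hb : big i c
        · rw [if_pos hb, if_pos (hc hb), Finset.card_insert_of_notMem (by simp),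
            Finset.card_insert_of_notMem (by simp)]
          omega
        · rw [if_neg hb]
          refine h2.trans ?_
          split_ifs
          · exact Finset.card_le_card (Finset.subset_insert _ _)
          · exact le_rfl
    · have e1 : M.filter (fun x => (if x = c then f p else a x) = i)
          = ((M.erase c).filter (fun x => a x = i)) := by
        ext x
        simp only [Finset.mem_filter, Finset.mem_erase]
        by_cases hx : x = c
        · simp [hx, hi]
        · simp [hx]
      have e2 : R.filter (fun q => f q = i) = ((R.erase p).filter (fun q => f q = i)) := by
        ext x
        simp only [Finset.mem_filter, Finset.mem_erase]
        by_cases hx : x = p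
        · simp [hx, hi]
        · simp [hx]
      rw [e1, e2]
      exact ha i

lemma bundleCost_eq {v : α → ℚ} {M : Finset α} {s l : ℚ} (h : Bivalued v M s l) {S : Finset α}
    (hS : S ⊆ M) [DecidablePred (fun c => v c = l)] :
    bundleCost v S = (#(S.filter (fun c => v c = l)) : ℚ) * l
      + #(S.filter (fun c => ¬ v c = l)) * s := by
  unfold bundleCost
  rw [← Finset.sum_filter_add_sum_filter_not S (fun c => v c = l)]
  congr 1
  · rw [Finset.sum_congr rfl (fun c hc => (Finset.mem_filter.1 hc).2)]
    simp
  · rw [Finset.sum_congr rfl (g := fun _ => s) (fun c hc => by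
      rw [Finset.mem_filter] at hc
      exact (h.2.2 c (hS hc.1)).resolve_right hc.2)]
    simp

lemma partition_card {M : Finset α} {d : ℕ} {P : Fin d → Finset α} (h : IsPartitionInto M d P)
    (q : α → Prop) [DecidablePred q] : #(M.filter q) = ∑ j, #((P j).filter q) := by
  rw [← Finset.card_biUnion]
  · congr 1
    ext c
    simp only [Finset.mem_filter, Finset.mem_biUnion, Finset.mem_univ, true_and]
    constructor
    · rintro ⟨hc, hq⟩
      obtain ⟨j, hj⟩ := h.2.2 c hc
      exact ⟨j, hj, hq⟩
    · rintro ⟨j, hj, hq⟩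
      exact ⟨h.1 j hj, hq⟩
  · intro j _ k _ hjk
    exact Finset.disjoint_filter_filter (h.2.1 j k hjk)

lemma exists_share (n : ℕ) (hn : 0 < n) (M : Finset α) (v : α → ℚ) :
    ∃ μ : ℚ, (∃ P : Fin n → Finset α, IsPartitionInto M n P ∧ ∀ j, bundleCost v (P j) ≤ μ) ∧
      ∀ μ', IsMMS v M n μ' → μ ≤ μ' := by
  by_cases h : ∃ μ, IsMMS v M n μ
  · obtain ⟨μ, h1, h2⟩ := h
    refine ⟨μ, h1, ?_⟩
    rintro μ' ⟨⟨P, hP, hP'⟩, -⟩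
    obtain ⟨j, hj⟩ := h2 P hP
    exact hj.trans (hP' j)
  · refine ⟨∑ j : Fin n, |bundleCost v (if j = ⟨0, hn⟩ then M else ∅)|,
      ⟨fun j => if j = ⟨0, hn⟩ then M else ∅, ⟨?_, ?_, ?_⟩, ?_⟩, fun μ' h' => (h ⟨μ', h'⟩).elim⟩
    · intro j
      dsimp only
      split_ifs <;> simp
    · intro j k hjk
      dsimp only
      split_ifs with h1 h2
      · exact (hjk (h1.trans h2.symm)).elim
      all_goals simp
    · intro c hc
      exact ⟨⟨0, hn⟩, by simpa using hc⟩
    · intro j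
      refine (le_abs_self _).trans ?_
      exact Finset.single_le_sum (f := fun j : Fin n => |bundleCost v (if j = ⟨0, hn⟩ then M else ∅)|)
        (fun _ _ => abs_nonneg _) (Finset.mem_univ j)

/-- `15/13`-MMS allocations exist for personalized bivalued chore instances. -/
theorem exists_15_13_mms_allocation_personalized_bivalued
    (n : ℕ) (hn : 0 < n) (M : Finset α)
    (v : Fin n → α → ℚ)
    (hbv : ∀ i, ∃ s l : ℚ, Bivalued (v i) M s l) :
    ∃ A : Fin n → Finset α, IsPartitionInto M n A ∧
      ∀ i, ∀ μ : ℚ, IsMMS (v i) M n μ → bundleCost (v i) (A i) ≤ 15 / 13 * μ := by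
  classical
  choose s l hbv using hbv
  choose μ hμ hμ' using fun i => exists_share n hn M (v i)
  choose P hP hPμ using hμ
  have hs : ∀ i, 0 < s i := fun i => (hbv i).1
  have hsl : ∀ i, s i < l i := fun i => (hbv i).2.1
  have hμ0 : ∀ i, 0 ≤ μ i := by
    intro i
    refine le_trans ?_ (hPμ i ⟨0, hn⟩)
    rw [bundleCost_eq (hbv i) ((hP i).1 _)]
    have := hs i
    have := hsl i
    have : 0 < l i := by linarith
    positivity
  have hgood := fun i => arith_main (l i / s i) (μ i / s i) (15 / 13 * (μ i / s i))
    ((one_lt_div (hs i)).2 (hsl i)) (div_nonneg (hμ0 i) (hs i).le) rfl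
  choose w W J Jm T g using hgood
  set big : Fin n → α → Prop := fun i c => v i c = l i with hbig
  set m := #M with hm
  set k : Fin n → ℕ := fun i => #(M.filter (big i)) with hk
  have hkm : ∀ i, k i ≤ m := fun i => Finset.card_filter_le _ _
  have hkm' : ∀ i, #(M.filter (fun c => ¬ big i c)) = m - k i := by
    intro i
    have := Finset.card_filter_add_card_filter_not (s := M) (big i)
    simp only [hk, hm]
    omega
  set t : Fin n → ℕ := fun i => m - k i with ht
  have hnS : ∀ i, nS (t i) (Finset.range m) = m - k i := by
    intro i
    unfold nS
    have : (Finset.range m).filter (fun p => ¬ t i ≤ p) = Finset.range (m - k i) := by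
      ext p
      simp only [Finset.mem_filter, Finset.mem_range, ht]
      omega
    rw [this, Finset.card_range]
  have hnLS : ∀ i (R : Finset ℕ), nL (t i) R + nS (t i) R = #R := fun i R =>
    Finset.card_filter_add_card_filter_not (s := R) (fun p => t i ≤ p)
  have hnL : ∀ i, nL (t i) (Finset.range m) = k i := by
    intro i
    have h1 := hnLS i (Finset.range m)
    rw [hnS, Finset.card_range] at h1
    have := hkm i
    omega
  have hinv : ∀ i, InvN (w i) (W i) (Jm i) (T i 0) n (k i) (m - k i) := by
    intro i
    have hL := partition_card (hP i) (big i)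
    have hS := partition_card (hP i) (fun c => ¬ big i c)
    rw [hkm' i] at hS
    have hj : ∀ j, (#((P i j).filter (big i)) : ℚ) * (l i / s i)
        + #((P i j).filter (fun c => ¬ big i c)) ≤ μ i / s i := by
      intro j
      have h1 := hPμ i j
      rw [bundleCost_eq (hbv i) ((hP i).1 j)] at h1
      rw [le_div_iff₀ (hs i)]
      have := (hs i).ne'
      calc _ = _ := by field_simp; simp only [hbig]; ring
        _ ≤ μ i := h1
    have hw : (k i : ℚ) * w i + (m - k i : ℕ) ≤ n * W i := by
      rw [hS, show k i = _ from hL]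
      push_cast
      rw [Finset.sum_mul, ← Finset.sum_add_distrib]
      refine (Finset.sum_le_sum (fun j _ => (g i).hO _ _ (hj j))).trans ?_
      simp
    refine ⟨?_, ?_, fun _ => hw⟩
    · rw [show k i = _ from hL]
      refine (Finset.sum_le_sum (fun j _ => (g i).hJm _ ?_)).trans (by simp : _ ≤ n * Jm i)
      refine le_trans ?_ (hj j)
      have : (0 : ℚ) ≤ #((P i j).filter (fun c => ¬ big i c)) := Nat.cast_nonneg _
      linarith
    · intro h0
      rw [h0] at hw ⊢
      have := mul_le_mul_of_nonneg_left (g i).hd (Nat.cast_nonneg n : (0 : ℚ) ≤ n)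
      have : ((m - 0 : ℕ) : ℚ) ≤ n * T i 0 := by
        push_cast at hw ⊢
        linarith
      exact_mod_cast this
  obtain ⟨n', rfl⟩ : ∃ n', n = n' + 1 := ⟨n - 1, by omega⟩
  obtain ⟨f, -, hf⟩ := ordered t _ _ _ w W J Jm T g n' Finset.univ (by simp) (Finset.range m)
    (by intro i _; rw [hnL, hnS]; exact hinv i)
  obtain ⟨a, ha⟩ := ido t big f m M (Finset.range m) rfl (by simp)
    (by intro i; rw [hnL])
  refine ⟨fun i => M.filter (fun c => a c = i), ⟨?_, ?_, ?_⟩, ?_⟩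
  · intro i; exact Finset.filter_subset _ _
  · intro i j hij
    rw [Finset.disjoint_filter]
    rintro c _ rfl h
    exact hij h
  · intro c hc
    exact ⟨a c, by simp [hc]⟩
  · intro i μ' hμi
    have h1 := hμ' i μ' hμi
    have h2 := hf i (Finset.mem_univ i)
    obtain ⟨h3, h4⟩ := ha i
    have h5 := hnLS i ((Finset.range m).filter (fun p => f p = i))
    rw [bundleCost_eq (hbv i) (Finset.filter_subset _ _)]
    have h6 := Finset.card_filter_add_card_filter_not (s := M.filter (fun c => a c = i)) (big i)
    rw [h3, ← h5] at h6
    generalize nL (t i) ((Finset.range m).filter (fun p => f p = i)) = x at *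
    generalize nS (t i) ((Finset.range m).filter (fun p => f p = i)) = y at *
    simp only [hbig] at h4 h6
    generalize #((M.filter (fun c => a c = i)).filter (fun c => v i c = l i)) = x' at *
    generalize #((M.filter (fun c => a c = i)).filter (fun c => ¬ v i c = l i)) = y' at *
    have h4' : (x' : ℚ) ≤ x := by exact_mod_cast h4
    have h6' : (x' : ℚ) + y' = x + y := by exact_mod_cast h6
    have hs0 := (hs i).ne'
    have h7 := mul_le_mul_of_nonneg_right h2 (hs i).le
    have e1 : ((x : ℚ) * (l i / s i) + y) * s i = x * l i + y * s i := by field_simp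
    have e2 : 15 / 13 * (μ i / s i) * s i = 15 / 13 * μ i := by field_simp
    rw [e1, e2] at h7
    have h8 := mul_le_mul_of_nonneg_right h4' (sub_nonneg.2 (hsl i).le)
    have h9 : (y' : ℚ) = x + y - x' := by linarith
    rw [h9]
    nlinarith
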